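/- Let 1 ≤ k ≤ n. If V is a k-dimensional totally nonnegative subspace of ℂⁿ with σ(V) = V, then V = V₀. Moreover σ(V₀) = V₀ and V₀ is totally positive. -/

import Mathlib

open scoped BigOperators

/-- The `t`-deformed left cyclic shift map on `ℂⁿ`:
`σ_t(v₁,…,vₙ) = (v₂,…,vₙ,(−1)^{k−1} t v₁)`. -/
noncomputable def cycShift (k n : ℕ) (t : ℂ) : (Fin n → ℂ) →ₗ[ℂ] (Fin n → ℂ) where
  toFun v := fun i =>
    if h : (i : ℕ) + 1 < n then v ⟨(i : ℕ) + 1, h⟩ else (-1 : ℂ) ^ (k - 1) * t * v ⟨0, i.pos⟩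
  map_add' u v := by
    funext i
    by_cases h : (i : ℕ) + 1 < n <;> simp [h, mul_add]
  map_smul' c v := by
    funext i
    by_cases h : (i : ℕ) + 1 < n <;> simp [h, mul_comm, mul_left_comm, mul_assoc]

/-- `V_S`: the span in `ℂⁿ` of the vectors `(1, z, …, z^{n-1})` for `z ∈ S`. -/
noncomputable def VS (n : ℕ) (S : Finset ℂ) : Submodule ℂ (Fin n → ℂ) :=
  Submodule.span ℂ ((fun z : ℂ => fun j : Fin n => z ^ (j : ℕ)) '' (S : Set ℂ))

/-- `S₀`: the `k` n-th roots of `(−1)^{k−1}` closest to `1` on the unit circle. -/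
noncomputable def S0 (k n : ℕ) : Finset ℂ :=
  Finset.image
    (fun j : Fin k => Complex.exp (Complex.I * ((2 * (j : ℝ) + 1 - k) * Real.pi / n)))
    Finset.univ

/-- The rows of a real `k × n` matrix, viewed as vectors in `ℂⁿ`. -/
def rowsC {k n : ℕ} (A : Matrix (Fin k) (Fin n) ℝ) : Fin k → (Fin n → ℂ) :=
  fun p j => (A p j : ℂ)

/-- A subspace `V ⊆ ℂⁿ` is totally nonnegative if it has a basis given by the rows
of a real `k × n` matrix all of whose `k × k` minors (columns in increasing order)
are nonnegative. -/
def IsTotallyNonneg (k n : ℕ) (V : Submodule ℂ (Fin n → ℂ)) : Prop :=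
  ∃ A : Matrix (Fin k) (Fin n) ℝ,
    LinearIndependent ℂ (rowsC A) ∧
    Submodule.span ℂ (Set.range (rowsC A)) = V ∧
    ∀ g : Fin k → Fin n, StrictMono g → 0 ≤ (A.submatrix id g).det

/-- Totally positive subspaces: as above but with strictly positive minors. -/
def IsTotallyPos (k n : ℕ) (V : Submodule ℂ (Fin n → ℂ)) : Prop :=
  ∃ A : Matrix (Fin k) (Fin n) ℝ,
    LinearIndependent ℂ (rowsC A) ∧
    Submodule.span ℂ (Set.range (rowsC A)) = V ∧
    ∀ g : Fin k → Fin n, StrictMono g → 0 < (A.submatrix id g).det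

/-- The `j`-th of the `n`-th roots of `(-1)^(k-1)`, indexed so that the first `k` of them are the
ones closest to `1`. -/
noncomputable def twistedRoot (k n : ℕ) (j : ℕ) : ℂ :=
  Complex.exp (Complex.I * ((2 * (j : ℝ) + 1 - k) * Real.pi / n))

/-- The vector `(1, z, …, z^{n-1})`. -/
def powVec (n : ℕ) (z : ℂ) : Fin n → ℂ := fun j => z ^ (j : ℕ)

theorem twistedRoot_ne_zero (k n j : ℕ) : twistedRoot k n j ≠ 0 := Complex.exp_ne_zero _

theorem twistedRoot_pow {k n : ℕ} (hk : 1 ≤ k) (hn : 0 < n) (j : ℕ) :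
    twistedRoot k n j ^ n = (-1) ^ (k - 1) := by
  obtain ⟨k, rfl⟩ : ∃ l, k = l + 1 := ⟨k - 1, by omega⟩
  have hn' : (n : ℂ) ≠ 0 := by exact_mod_cast hn.ne'
  rw [twistedRoot, ← Complex.exp_nat_mul]
  have h : (n : ℂ) * (Complex.I * ((2 * ((j : ℝ) : ℂ) + 1 - ((k + 1 : ℕ) : ℂ)) * Real.pi / n))
      = j * (2 * Real.pi * Complex.I) - k * (Real.pi * Complex.I) := by
    push_cast
    field_simp
    ring
  rw [h, Complex.exp_sub, Complex.exp_nat_mul_two_pi_mul_I, Complex.exp_nat_mul,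
    Complex.exp_pi_mul_I]
  rcases Nat.even_or_odd k with h | h <;> simp [h.neg_one_pow]

theorem twistedRoot_injective {k n : ℕ} (hn : 0 < n) :
    Function.Injective fun j : Fin n => twistedRoot k n j := by
  intro i j hij
  have hn' : (n : ℂ) ≠ 0 := by exact_mod_cast hn.ne'
  have hpi : (Real.pi : ℂ) ≠ 0 := by exact_mod_cast Real.pi_ne_zero
  obtain ⟨m, hm⟩ := Complex.exp_eq_exp_iff_exists_int.1 hij
  have h : (2 * Real.pi * Complex.I : ℂ) * i = (2 * Real.pi * Complex.I : ℂ) * (j + m * n) := by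
    field_simp at hm
    push_cast at hm
    linear_combination (Real.pi : ℂ) * Complex.I * hm
  have h2 : ((i : ℕ) : ℂ) = (j : ℕ) + m * n := mul_left_cancel₀ Complex.two_pi_I_ne_zero h
  have h3 : ((i : ℕ) : ℤ) = (j : ℕ) + m * n := by exact_mod_cast h2
  have hi := i.isLt
  have hj := j.isLt
  have hm0 : m = 0 := by
    have h1 : m < 1 := by nlinarith
    have h2 : -1 < m := by nlinarith
    omega
  subst hm0
  ext
  simpa using h3

theorem twistedRoot_mul_rev {k n j : ℕ} (hj : j < k) :
    twistedRoot k n j * twistedRoot k n (k - 1 - j) = 1 := by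
  obtain ⟨l, rfl⟩ : ∃ l, k = j + l + 1 := ⟨k - 1 - j, by omega⟩
  rw [twistedRoot, twistedRoot, ← Complex.exp_add, show j + l + 1 - 1 - j = l by omega]
  rw [Complex.exp_eq_one_iff]
  refine ⟨0, ?_⟩
  push_cast
  ring

theorem mem_S0 {k n : ℕ} {z : ℂ} : z ∈ S0 k n ↔ ∃ j : Fin k, twistedRoot k n j = z := by
  simp [S0, twistedRoot]

theorem inv_mem_S0 {k n : ℕ} {z : ℂ} (hz : z ∈ S0 k n) : z⁻¹ ∈ S0 k n := by
  obtain ⟨j, rfl⟩ := mem_S0.1 hz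
  have hj := j.isLt
  exact mem_S0.2 ⟨⟨k - 1 - j, by omega⟩, eq_inv_of_mul_eq_one_right (twistedRoot_mul_rev hj)⟩

theorem VS_S0_eq_span (k n : ℕ) :
    VS n (S0 k n) = Submodule.span ℂ (Set.range fun j : Fin k => powVec n (twistedRoot k n j)) := by
  rw [VS]
  congr 1
  ext v
  simp only [Set.mem_image, Finset.mem_coe, mem_S0, Set.mem_range]
  constructor
  · rintro ⟨_, ⟨j, rfl⟩, rfl⟩
    exact ⟨j, rfl⟩
  · rintro ⟨j, rfl⟩
    exact ⟨_, ⟨j, rfl⟩, rfl⟩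

theorem powVec_mem_VS {n : ℕ} {S : Finset ℂ} {z : ℂ} (hz : z ∈ S) : powVec n z ∈ VS n S :=
  Submodule.subset_span ⟨z, hz, rfl⟩

theorem cycShift_powVec {k n : ℕ} {z : ℂ} (hz : z ^ n = (-1) ^ (k - 1)) :
    cycShift k n 1 (powVec n z) = z • powVec n z := by
  funext i
  have hi := i.isLt
  simp only [cycShift, powVec, LinearMap.coe_mk, AddHom.coe_mk, Pi.smul_apply, smul_eq_mul]
  split_ifs with h
  · ring
  · rw [← hz, ← pow_succ', show (i : ℕ) + 1 = n by omega]
    simp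

theorem pow_eq_of_mem_S0 {k n : ℕ} (hk : 1 ≤ k) (hn : 0 < n) {z : ℂ} (hz : z ∈ S0 k n) :
    z ^ n = (-1) ^ (k - 1) := by
  obtain ⟨j, rfl⟩ := mem_S0.1 hz
  exact twistedRoot_pow hk hn j

theorem map_cycShift_VS_S0 {k n : ℕ} (hk : 1 ≤ k) (hn : 0 < n) :
    Submodule.map (cycShift k n 1) (VS n (S0 k n)) = VS n (S0 k n) := by
  apply le_antisymm
  · rw [VS, Submodule.map_span_le]
    rintro _ ⟨z, hz, rfl⟩
    exact (cycShift_powVec (pow_eq_of_mem_S0 hk hn hz)).symm ▸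
      Submodule.smul_mem _ _ (powVec_mem_VS hz)
  · conv_lhs => rw [VS]
    rw [Submodule.span_le]
    rintro _ ⟨z, hz, rfl⟩
    refine ⟨z⁻¹ • powVec n z, Submodule.smul_mem _ _ (powVec_mem_VS hz), ?_⟩
    have hz0 : z ≠ 0 := by
      obtain ⟨j, rfl⟩ := mem_S0.1 hz
      exact twistedRoot_ne_zero k n j
    rw [map_smul, cycShift_powVec (pow_eq_of_mem_S0 hk hn hz), smul_smul, inv_mul_cancel₀ hz0,
      one_smul]
    rfl

theorem linearIndependent_powVec_twistedRoot {k n : ℕ} (hn : 0 < n) :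
    LinearIndependent ℂ fun j : Fin n => powVec n (twistedRoot k n j) :=
  Matrix.linearIndependent_rows_of_det_ne_zero
    (Matrix.det_vandermonde_ne_zero_iff.2 (twistedRoot_injective (k := k) hn))

theorem iSup_eigenspace_cycShift {k n : ℕ} (hk : 1 ≤ k) (hn : 0 < n) :
    ⨆ μ, Module.End.eigenspace (cycShift k n 1) μ = ⊤ := by
  rw [eq_top_iff, ← (linearIndependent_powVec_twistedRoot (k := k)
    hn).span_eq_top_of_card_eq_finrank' (by simp), Submodule.span_le]
  rintro _ ⟨j, rfl⟩
  exact Submodule.mem_iSup_of_mem _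
    (Module.End.mem_eigenspace_iff.2 (cycShift_powVec (twistedRoot_pow hk hn j)))

theorem eq_smul_powVec_of_mem_eigenspace {k n : ℕ} (hn : 0 < n) {μ : ℂ} {u : Fin n → ℂ}
    (hu : cycShift k n 1 u = μ • u) : u = u ⟨0, hn⟩ • powVec n μ := by
  have key : ∀ (i : ℕ) (hi : i < n), u ⟨i, hi⟩ = u ⟨0, hn⟩ * μ ^ i := by
    intro i
    induction i with
    | zero => simp
    | succ i ih =>
      intro hi
      have h := congrFun hu ⟨i, by omega⟩
      simp only [cycShift, LinearMap.coe_mk, AddHom.coe_mk, hi, dif_pos, Pi.smul_apply,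
        smul_eq_mul] at h
      rw [h, ih]
      ring
  funext i
  exact key i i.isLt

/-- For the bilinear dot product, the transpose of the cyclic shift is its inverse. -/
theorem cycShift_dotProduct_powVec {k n : ℕ} (hn : 0 < n) {s : ℂ} (hs : s ^ n = (-1) ^ (k - 1))
    (u : Fin n → ℂ) :
    s * (cycShift k n 1 u ⬝ᵥ powVec n s) = u ⬝ᵥ powVec n s := by
  obtain ⟨n, rfl⟩ : ∃ m, n = m + 1 := ⟨n - 1, by omega⟩
  have hsq : s ^ (n + 1) * s ^ (n + 1) = 1 := by
    rw [hs, ← mul_pow]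
    simp
  simp only [dotProduct, powVec]
  rw [Fin.sum_univ_castSucc, Fin.sum_univ_succ (n := n) (fun i => u i * s ^ (i : ℕ)), mul_add,
    Finset.mul_sum, add_comm]
  congr 1
  · simp only [cycShift, LinearMap.coe_mk, AddHom.coe_mk, Fin.val_last, lt_irrefl, dif_neg,
      not_false_eq_true, ← hs]
    simp only [Fin.val_zero, pow_zero, mul_one]
    rw [show (⟨0, n.succ_pos⟩ : Fin (n + 1)) = 0 from rfl]
    linear_combination u 0 * hsq
  · refine Finset.sum_congr rfl fun i _ => ?_
    have hi : (i : ℕ) + 1 < n + 1 := by omega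
    simp only [cycShift, LinearMap.coe_mk, AddHom.coe_mk, Fin.val_castSucc, hi, dif_pos,
      Fin.val_succ]
    rw [show (⟨(i : ℕ) + 1, hi⟩ : Fin (n + 1)) = i.succ from rfl]
    ring

theorem exists_orthogonal_of_not_le {k n : ℕ} (hk : 1 ≤ k) (hn : 0 < n)
    {V : Submodule ℂ (Fin n → ℂ)} (hV : Submodule.map (cycShift k n 1) V = V)
    (hle : ¬ V ≤ VS n (S0 k n)) :
    ∃ u ∈ V, u ≠ 0 ∧ ∀ w ∈ VS n (S0 k n), u ⬝ᵥ w = 0 := by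
  have hinv : ∀ v ∈ V, cycShift k n 1 v ∈ V := fun v hv => hV ▸ Submodule.mem_map_of_mem hv
  have hdecomp := Submodule.inf_iSup_genEigenspace (k := 1) hinv
  have htop := iSup_eigenspace_cycShift (k := k) hk hn
  simp only [Module.End.eigenspace] at htop
  rw [htop, inf_top_eq] at hdecomp
  rw [hdecomp, iSup_le_iff] at hle
  push Not at hle
  obtain ⟨μ, hμ⟩ := hle
  obtain ⟨u, ⟨huV, huμ⟩, hu0⟩ := SetLike.not_le_iff_exists.1 hμ
  have hu : cycShift k n 1 u = μ • u := Module.End.mem_eigenspace_iff.1 huμ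
  have hμS : μ ∉ S0 k n := fun h =>
    hu0 ((eq_smul_powVec_of_mem_eigenspace hn hu).symm ▸ Submodule.smul_mem _ _ (powVec_mem_VS h))
  refine ⟨u, huV, fun h => hu0 (h ▸ zero_mem _), fun w hw => ?_⟩
  induction hw using Submodule.span_induction with
  | zero => simp
  | add x y _ _ hx hy => rw [dotProduct_add, hx, hy, add_zero]
  | smul a x _ hx => rw [dotProduct_smul, hx, smul_zero]
  | mem x hx =>
    obtain ⟨s, hs, rfl⟩ := hx
    have h := cycShift_dotProduct_powVec hn (pow_eq_of_mem_S0 hk hn hs) u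
    rw [hu, smul_dotProduct, smul_eq_mul] at h
    have hsμ : s * μ - 1 ≠ 0 := fun h' =>
      hμS (eq_inv_of_mul_eq_one_right (sub_eq_zero.1 h') ▸ inv_mem_S0 hs)
    exact (mul_eq_zero.1 (by linear_combination h :
      (s * μ - 1) * (u ⬝ᵥ powVec n s) = 0)).resolve_left hsμ

theorem Matrix.det_mul_eq_sum_prod_mul_det {m n R : Type*} [CommRing R] [Fintype m] [DecidableEq m]
    [Fintype n] [DecidableEq n] (A : Matrix m n R) (B : Matrix n m R) :
    (A * B).det = ∑ g : m → n, (∏ i, A i (g i)) * (B.submatrix g id).det := by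
  have h : A * B = fun i => ∑ j, A i j • B j := by
    ext i l
    simp [Matrix.mul_apply]
  rw [h]
  change Matrix.detRowAlternating.toMultilinearMap _ = _
  rw [MultilinearMap.map_sum]
  refine Finset.sum_congr rfl fun g _ => ?_
  rw [MultilinearMap.map_smul_univ]
  rfl

/-- The Cauchy–Binet formula, summing over all column selections rather than increasing ones. -/
theorem Matrix.factorial_mul_det_mul {m n R : Type*} [CommRing R] [Fintype m] [DecidableEq m]
    [Fintype n] [DecidableEq n] (A : Matrix m n R) (B : Matrix n m R) :
    ((Fintype.card m).factorial : R) * (A * B).det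
      = ∑ g : m → n, (A.submatrix id g).det * (B.submatrix g id).det := by
  have h : ∀ τ : Equiv.Perm m, (A * B).det = ∑ g : m → n,
      (Equiv.Perm.sign τ : R) * (∏ i, A i (g (τ i))) * (B.submatrix g id).det := by
    intro τ
    rw [Matrix.det_mul_eq_sum_prod_mul_det]
    refine Fintype.sum_equiv (τ.arrowCongr (Equiv.refl n)) _ _ fun g => ?_
    have h1 : B.submatrix (τ.arrowCongr (Equiv.refl n) g) id
        = (B.submatrix g id).submatrix τ.symm id := rfl
    have h2 : ((Equiv.Perm.sign τ : ℤ) : R) * ((Equiv.Perm.sign τ : ℤ) : R) = 1 := by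
      rw [← Int.cast_mul, ← Units.val_mul, Int.units_mul_self]
      simp
    rw [h1, Matrix.det_permute, show Equiv.Perm.sign τ.symm = Equiv.Perm.sign τ from
      Equiv.Perm.sign_symm τ]
    simp only [Equiv.arrowCongr_apply, Function.comp, Equiv.symm_apply_apply, Equiv.refl_apply]
    linear_combination -(∏ i, A i (g i)) * (B.submatrix g id).det * h2
  calc ((Fintype.card m).factorial : R) * (A * B).det
      = ∑ _τ : Equiv.Perm m, (A * B).det := by simp [Fintype.card_perm]
    _ = ∑ τ : Equiv.Perm m, ∑ g : m → n,
        (Equiv.Perm.sign τ : R) * (∏ i, A i (g (τ i))) * (B.submatrix g id).det :=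
      Finset.sum_congr rfl fun τ _ => h τ
    _ = _ := by
      rw [Finset.sum_comm]
      refine Finset.sum_congr rfl fun g _ => ?_
      rw [← Finset.sum_mul, ← Matrix.det_transpose (A.submatrix id g),
        Matrix.det_apply' (A.submatrix id g).transpose]
      rfl

theorem Matrix.exists_strictMono_det_submatrix {k n : ℕ} {R : Type*} [CommRing R]
    {g : Fin k → Fin n} (hg : Function.Injective g) :
    ∃ g' : Fin k → Fin n, StrictMono g' ∧ ∃ ε : ℤˣ, ∀ A : Matrix (Fin k) (Fin n) R,
      (A.submatrix id g').det = (ε : ℤ) * (A.submatrix id g).det := by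
  refine ⟨g ∘ Tuple.sort g, (Tuple.monotone_sort g).strictMono_of_injective
    (hg.comp (Tuple.sort g).injective), Equiv.Perm.sign (Tuple.sort g), fun A => ?_⟩
  rw [← Matrix.det_permute']
  rfl

theorem Matrix.det_submatrix_eq_zero_of_not_injective {m n R : Type*} [CommRing R] [Fintype m]
    [DecidableEq m] (A : Matrix m n R) {g : m → n} (hg : ¬ Function.Injective g) :
    (A.submatrix id g).det = 0 := by
  rw [Function.not_injective_iff] at hg
  obtain ⟨a, b, hab, hne⟩ := hg
  exact Matrix.det_zero_of_column_eq hne fun i => by simp [hab]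

theorem Matrix.exists_det_submatrix_ne_zero {m n : Type*} [Fintype m] [DecidableEq m] [Fintype n]
    [DecidableEq n] {A : Matrix m n ℝ} (hA : LinearIndependent ℝ A.row) :
    ∃ g : m → n, (A.submatrix id g).det ≠ 0 := by
  by_contra! h
  have h0 := Matrix.factorial_mul_det_mul A A.conjTranspose
  simp only [h, zero_mul, Finset.sum_const_zero] at h0
  have hdet := (mul_eq_zero.1 h0).resolve_left (by positivity)
  obtain ⟨v, hv, hv0⟩ := Matrix.exists_vecMul_eq_zero_iff.2 hdet
  rw [Matrix.vecMul_self_mul_conjTranspose_eq_zero] at hv0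
  exact hv (Matrix.vecMul_injective_iff.2 hA (by simpa using hv0))

theorem Matrix.det_mul_transpose_pos {k n : ℕ} {A B : Matrix (Fin k) (Fin n) ℝ}
    (hA : LinearIndependent ℝ A.row)
    (hA0 : ∀ g : Fin k → Fin n, StrictMono g → 0 ≤ (A.submatrix id g).det)
    (hB : ∀ g : Fin k → Fin n, StrictMono g → 0 < (B.submatrix id g).det) :
    0 < (A * B.transpose).det := by
  have hkey : ∀ g : Fin k → Fin n, 0 ≤ (A.submatrix id g).det * (B.submatrix id g).det ∧
      ((A.submatrix id g).det ≠ 0 → (A.submatrix id g).det * (B.submatrix id g).det ≠ 0) := by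
    intro g
    by_cases hg : Function.Injective g
    · obtain ⟨g', hg', ε, hε⟩ := Matrix.exists_strictMono_det_submatrix (R := ℝ) hg
      have h1 := hA0 g' hg'
      have h2 := hB g' hg'
      rw [hε] at h1 h2
      rcases Int.units_eq_one_or ε with rfl | rfl
      · simp only [Units.val_one, Int.cast_one, one_mul] at h1 h2
        exact ⟨mul_nonneg h1 h2.le, fun h => mul_ne_zero h h2.ne'⟩
      · simp only [Units.val_neg, Units.val_one, Int.cast_neg, Int.cast_one, neg_mul, one_mul]
          at h1 h2
        exact ⟨by nlinarith, fun h => mul_ne_zero h (by linarith)⟩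
    · rw [Matrix.det_submatrix_eq_zero_of_not_injective A hg]
      simp
  have hsum := Matrix.factorial_mul_det_mul A B.transpose
  have hT : ∀ g : Fin k → Fin n, (B.transpose.submatrix g id).det = (B.submatrix id g).det :=
    fun g => by rw [← Matrix.transpose_submatrix, Matrix.det_transpose]
  simp only [hT] at hsum
  obtain ⟨g, hg⟩ := Matrix.exists_det_submatrix_ne_zero hA
  have hpos : 0 < ∑ g : Fin k → Fin n, (A.submatrix id g).det * (B.submatrix id g).det :=
    Finset.sum_pos' (fun g _ => (hkey g).1)
      ⟨g, Finset.mem_univ g, lt_of_le_of_ne (hkey g).1 ((hkey g).2 hg).symm⟩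
  rw [← hsum] at hpos
  exact pos_of_mul_pos_right hpos (by positivity)

theorem linearIndependent_row_of_rowsC {k n : ℕ} {A : Matrix (Fin k) (Fin n) ℝ}
    (hA : LinearIndependent ℂ (rowsC A)) : LinearIndependent ℝ A.row := by
  have h : LinearIndependent ℝ (rowsC A) := hA.restrict_scalars' ℝ
  rw [Fintype.linearIndependent_iff] at h ⊢
  intro c hc
  apply h c
  funext j
  have := congrFun hc j
  simp only [Finset.sum_apply, Pi.smul_apply, Matrix.row_apply, smul_eq_mul, Pi.zero_apply] at this
  simp only [Finset.sum_apply, Pi.smul_apply, rowsC, Complex.real_smul, Pi.zero_apply]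
  exact_mod_cast this

/-- A nonzero vector of a totally nonnegative subspace is not orthogonal to a totally positive
subspace of the same dimension. -/
theorem exists_dotProduct_ne_zero {k n : ℕ} {V W : Submodule ℂ (Fin n → ℂ)}
    (hV : IsTotallyNonneg k n V) (hW : IsTotallyPos k n W) {u : Fin n → ℂ} (hu : u ∈ V)
    (hu0 : u ≠ 0) : ∃ w ∈ W, u ⬝ᵥ w ≠ 0 := by
  obtain ⟨A, hA, rfl, hA0⟩ := hV
  obtain ⟨B, hB, rfl, hB0⟩ := hW
  by_contra! h
  obtain ⟨c, rfl⟩ := (Submodule.mem_span_range_iff_exists_fun ℂ).1 hu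
  have hpos := Matrix.det_mul_transpose_pos (linearIndependent_row_of_rowsC hA) hA0 hB0
  have hdet : ((A * B.transpose).map Complex.ofRealHom).det = 0 := by
    refine Matrix.exists_vecMul_eq_zero_iff.1 ⟨c, fun hc => hu0 (by simp [hc]), ?_⟩
    funext p
    have hp := h _ (Submodule.subset_span (Set.mem_range_self p))
    rw [Pi.zero_apply, ← hp, sum_dotProduct]
    simp only [Matrix.vecMul, dotProduct, Matrix.map_apply, Matrix.mul_apply,
      Matrix.transpose_apply, Pi.smul_apply, rowsC, smul_eq_mul, map_sum, map_mul,
      Complex.ofRealHom_eq_coe, Finset.mul_sum, mul_assoc]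
  rw [← RingHom.mapMatrix_apply, ← RingHom.map_det, Complex.ofRealHom_eq_coe,
    Complex.ofReal_eq_zero] at hdet
  exact hpos.ne' hdet

/-- The product of sines giving, up to a constant, the Plücker coordinates of `V₀`. -/
noncomputable def sineProd {k n : ℕ} (g : Fin k → Fin n) : ℝ :=
  ∏ a : Fin k, ∏ b ∈ Finset.Ioi a, Real.sin (((g b : ℝ) - (g a : ℝ)) * Real.pi / n)

theorem sineProd_pos {k n : ℕ} {g : Fin k → Fin n} (hg : StrictMono g) : 0 < sineProd g := by
  refine Finset.prod_pos fun a _ => Finset.prod_pos fun b hb => ?_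
  have hab : ((g a : ℕ) : ℝ) < (g b : ℕ) := by exact_mod_cast hg (Finset.mem_Ioi.1 hb)
  have hbn : ((g b : ℕ) : ℝ) < n := by exact_mod_cast (g b).isLt
  have ha : (0 : ℝ) ≤ ((g a : ℕ) : ℝ) := Nat.cast_nonneg _
  have hn : (0 : ℝ) < n := by linarith
  apply Real.sin_pos_of_pos_of_lt_pi
  · have := Real.pi_pos
    have : 0 < ((g b : ℕ) : ℝ) - (g a : ℕ) := by linarith
    positivity
  · rw [div_lt_iff₀ hn, mul_comm]
    exact mul_lt_mul_of_pos_left (by linarith) Real.pi_pos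

/-- The matrix whose rows are the `powVec`s spanning `V₀`. -/
noncomputable def rootMatrix (k n : ℕ) : Matrix (Fin k) (Fin n) ℂ :=
  Matrix.of fun j => powVec n (twistedRoot k n j)

theorem det_rootMatrix_submatrix {k n : ℕ} (hk : 1 ≤ k) (g : Fin k → Fin n) :
    ((rootMatrix k n).submatrix id g).det
      = (∏ a : Fin k, ∏ _b ∈ Finset.Ioi a, 2 * Complex.I) * sineProd g := by
  set u : Fin k → ℂ := fun a => Complex.exp (Complex.I * ((g a : ℕ) * Real.pi / n)) with hu
  have hu0 : ∀ a, u a ≠ 0 := fun a => Complex.exp_ne_zero _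
  have hT : ((rootMatrix k n).submatrix id g).transpose
      = Matrix.of fun a j => (u a ^ (k - 1))⁻¹ * Matrix.vandermonde (fun a => u a ^ 2) a j := by
    ext a j
    obtain ⟨l, rfl⟩ : ∃ l, k = l + 1 := ⟨k - 1, by omega⟩
    simp only [rootMatrix, powVec, twistedRoot, Matrix.transpose_apply, Matrix.submatrix_apply,
      Matrix.of_apply, Matrix.vandermonde_apply, id, hu]
    rw [← Complex.exp_nat_mul, ← Complex.exp_nat_mul, ← Complex.exp_nat_mul,
      ← Complex.exp_nat_mul, ← Complex.exp_neg, ← Complex.exp_add]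
    congr 1
    push_cast
    ring
  have hoff : ∏ a : Fin k, ∏ b ∈ Finset.Ioi a, (u a * u b) = ∏ a, u a ^ (k - 1) := by
    rw [Finset.prod_prod_Ioi_mul_eq_prod_prod_off_diag fun _ b => u b]
    simp [Finset.card_compl]
  have hdiff : ∀ a b, u b ^ 2 - u a ^ 2 = (u a * u b) * ((2 * Complex.I) *
      (Real.sin (((g b : ℝ) - (g a : ℝ)) * Real.pi / n) : ℂ)) := by
    intro a b
    have h1 : u b * (u a)⁻¹ = Complex.exp ((((g b : ℝ) - (g a : ℝ)) * Real.pi / n : ℝ) *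
        Complex.I) := by
      rw [hu, ← Complex.exp_neg, ← Complex.exp_add]
      congr 1
      push_cast
      ring
    have h2 : u a * (u b)⁻¹ = Complex.exp (-(((g b : ℝ) - (g a : ℝ)) * Real.pi / n : ℝ) *
        Complex.I) := by
      rw [hu, ← Complex.exp_neg, ← Complex.exp_add]
      congr 1
      push_cast
      ring
    rw [Complex.ofReal_sin, Complex.sin, ← h1, ← h2]
    have ha := hu0 a
    have hb := hu0 b
    field_simp
    linear_combination (u b ^ 2 - u a ^ 2) * Complex.I_sq
  rw [← Matrix.det_transpose, hT, Matrix.det_mul_column, Matrix.det_vandermonde]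
  have hprod : ∏ a, u a ^ (k - 1) ≠ 0 := Finset.prod_ne_zero_iff.2 fun a _ => pow_ne_zero _ (hu0 a)
  have hfactor : ∏ a : Fin k, ∏ b ∈ Finset.Ioi a, (u b ^ 2 - u a ^ 2)
      = (∏ a, u a ^ (k - 1)) *
        ((∏ a : Fin k, ∏ _b ∈ Finset.Ioi a, 2 * Complex.I) * sineProd g) := by
    rw [← hoff, sineProd]
    simp_rw [hdiff]
    simp only [Complex.ofReal_prod, ← Finset.prod_mul_distrib]
  rw [hfactor, Finset.prod_inv_distrib, inv_mul_cancel_left₀ hprod]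

/-- The real matrix representing `V₀`, normalised so that its first `k` columns are the identity. -/
noncomputable def echelonMatrix {k n : ℕ} (hkn : k ≤ n) : Matrix (Fin k) (Fin n) ℝ :=
  Matrix.of fun p m => sineProd (Function.update (Fin.castLE hkn) p m) / sineProd (Fin.castLE hkn)

theorem det_rootMatrix_castLE_ne_zero {k n : ℕ} (hk : 1 ≤ k) (hkn : k ≤ n) :
    ((rootMatrix k n).submatrix id (Fin.castLE hkn)).det ≠ 0 := by
  rw [det_rootMatrix_submatrix hk]
  refine mul_ne_zero (Finset.prod_ne_zero_iff.2 fun _ _ => Finset.prod_ne_zero_iff.2 fun _ _ => ?_)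
    (Complex.ofReal_ne_zero.2 (sineProd_pos (Fin.strictMono_castLE hkn)).ne')
  simp

theorem castLE_submatrix_mul_echelonMatrix {k n : ℕ} (hk : 1 ≤ k) (hkn : k ≤ n) :
    (rootMatrix k n).submatrix id (Fin.castLE hkn) * (echelonMatrix hkn).map Complex.ofRealHom
      = rootMatrix k n := by
  set N := (rootMatrix k n).submatrix id (Fin.castLE hkn) with hN
  have hN0 : N.det ≠ 0 := det_rootMatrix_castLE_ne_zero hk hkn
  ext i m
  have hcol : (fun p => ((echelonMatrix hkn) p m : ℂ))
      = N.det⁻¹ • N.cramer fun q => rootMatrix k n q m := by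
    funext p
    have hup : N.updateCol p (fun q => rootMatrix k n q m)
        = (rootMatrix k n).submatrix id (Function.update (Fin.castLE hkn) p m) := by
      ext q r
      by_cases h : r = p
      · subst h
        simp
      · simp [h, hN]
    rw [Pi.smul_apply, Matrix.cramer_apply, hup, hN, det_rootMatrix_submatrix hk,
      det_rootMatrix_submatrix hk, smul_eq_mul]
    have hc : (∏ a : Fin k, ∏ _b ∈ Finset.Ioi a, 2 * Complex.I) ≠ 0 :=
      Finset.prod_ne_zero_iff.2 fun _ _ => Finset.prod_ne_zero_iff.2 fun _ _ => by simp
    have hs : (sineProd (Fin.castLE hkn) : ℂ) ≠ 0 :=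
      Complex.ofReal_ne_zero.2 (sineProd_pos (Fin.strictMono_castLE hkn)).ne'
    simp only [echelonMatrix, Matrix.of_apply, Complex.ofReal_div]
    field_simp
  have h := congrFun (Matrix.mulVec_cramer N fun q => rootMatrix k n q m) i
  change N.mulVec (fun p => ((echelonMatrix hkn) p m : ℂ)) i = _
  rw [hcol, Matrix.mulVec_smul, Pi.smul_apply, h, Pi.smul_apply, smul_eq_mul, smul_eq_mul,
    inv_mul_cancel_left₀ hN0]

theorem isTotallyPos_VS_S0 {k n : ℕ} (hk : 1 ≤ k) (hkn : k ≤ n) :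
    IsTotallyPos k n (VS n (S0 k n)) := by
  set N := (rootMatrix k n).submatrix id (Fin.castLE hkn) with hN
  have hN0 : N.det ≠ 0 := det_rootMatrix_castLE_ne_zero hk hkn
  have hmul := castLE_submatrix_mul_echelonMatrix hk hkn
  rw [← hN] at hmul
  have hspan : Submodule.span ℂ (Set.range (rowsC (echelonMatrix hkn))) = VS n (S0 k n) := by
    have hrow : ∀ (P : Matrix (Fin k) (Fin k) ℂ) (B C : Matrix (Fin k) (Fin n) ℂ), P * B = C →
        Submodule.span ℂ (Set.range C.row) ≤ Submodule.span ℂ (Set.range B.row) := by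
      rintro P B _ rfl
      rw [Submodule.span_le]
      rintro _ ⟨i, rfl⟩
      refine (Submodule.mem_span_range_iff_exists_fun ℂ).2 ⟨P i, ?_⟩
      ext j
      simp [Matrix.mul_apply]
    have hinv : N⁻¹ * rootMatrix k n = (echelonMatrix hkn).map Complex.ofRealHom := by
      rw [← hmul, Matrix.nonsing_inv_mul_cancel_left _ _ (isUnit_iff_ne_zero.2 hN0)]
    rw [VS_S0_eq_span]
    exact le_antisymm (hrow _ _ _ hinv) (hrow _ _ _ hmul)
  refine ⟨echelonMatrix hkn, ?_, hspan, fun g hg => ?_⟩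
  · rw [linearIndependent_iff_card_eq_finrank_span, Set.finrank, hspan, VS_S0_eq_span,
      finrank_span_eq_card]
    exact (linearIndependent_powVec_twistedRoot (k := k) (hk.trans hkn)).comp (Fin.castLE hkn)
      (Fin.castLE_injective hkn)
  · have hdet := congrArg Matrix.det (congrArg (fun M => M.submatrix id g) hmul)
    rw [Matrix.submatrix_mul _ _ _ id _ Function.bijective_id] at hdet
    have hmap : ((echelonMatrix hkn).map Complex.ofRealHom).submatrix id g
        = Complex.ofRealHom.mapMatrix ((echelonMatrix hkn).submatrix id g) := rfl
    rw [Matrix.det_mul, det_rootMatrix_submatrix hk, hN, Matrix.submatrix_submatrix, hmap,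
      ← RingHom.map_det, Function.comp_id, det_rootMatrix_submatrix hk, mul_assoc] at hdet
    have hc : (∏ a : Fin k, ∏ _b ∈ Finset.Ioi a, 2 * Complex.I) ≠ 0 :=
      Finset.prod_ne_zero_iff.2 fun _ _ => Finset.prod_ne_zero_iff.2 fun _ _ => by simp
    have hreal : sineProd (Fin.castLE hkn) * ((echelonMatrix hkn).submatrix id g).det
        = sineProd g := by
      have h := mul_left_cancel₀ hc hdet
      rw [Complex.ofRealHom_eq_coe] at h
      exact_mod_cast h
    exact pos_of_mul_pos_right (hreal ▸ sineProd_pos hg)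
      (sineProd_pos (Fin.strictMono_castLE hkn)).le

/-- For `1 ≤ k ≤ n`: every `k`-dimensional totally nonnegative subspace
`V ⊆ ℂⁿ` with `σ(V) = V` equals `V₀`; moreover `σ(V₀) = V₀` and `V₀` is totally positive. -/
theorem unique_tnn_fixed_point (k n : ℕ) (hk : 1 ≤ k) (hkn : k ≤ n) :
    (∀ V : Submodule ℂ (Fin n → ℂ),
        Module.finrank ℂ V = k → IsTotallyNonneg k n V →
          Submodule.map (cycShift k n 1) V = V → V = VS n (S0 k n)) ∧
      Submodule.map (cycShift k n 1) (VS n (S0 k n)) = VS n (S0 k n) ∧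
      IsTotallyPos k n (VS n (S0 k n)) := by
  have hpos := isTotallyPos_VS_S0 hk hkn
  refine ⟨fun V hdim hV hσ => ?_, map_cycShift_VS_S0 hk (hk.trans hkn), hpos⟩
  have hle : V ≤ VS n (S0 k n) := by
    by_contra hle
    obtain ⟨u, huV, hu0, hu⟩ := exists_orthogonal_of_not_le hk (hk.trans hkn) hσ hle
    obtain ⟨w, hw, hne⟩ := exists_dotProduct_ne_zero hV hpos huV hu0
    exact hne (hu w hw)
  refine Submodule.eq_of_le_of_finrank_le hle ?_
  obtain ⟨B, hB, hspan, -⟩ := hpos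
  rw [hdim, ← hspan, finrank_span_eq_card hB, Fintype.card_fin]
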